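/- Let a_x, a_y, A_x, A_y > 0 be reals, let B̃_x, B̃_y : ℕ → ℝ be given by B̃_x(n) = (P_xⁿ/(n!)²)/a_x with P_x = K_x(1+K_x)/Ω_x and B̃_y(k) = (Q_y^k/(k!)²)/a_y with Q_y = K_y(1+K_y)/Ω_y for some reals K_x, K_y ≥ 0 and Ω_x, Ω_y > 0, where a_x = (1+K_x)/Ω_x, a_y = (1+K_y)/Ω_y, A_x = a_x e^{−K_x}, A_y = a_y e^{−K_y}. Define the tail function T(z) = A_x A_y ∑_{n=0}^∞ ∑_{k=0}^∞ B̃_x(n) B̃_y(k) Γ(n+1, a_x z) Γ(k+1, a_y z) for z ≥ 0. Then for every real ρ > 0, ρ · ∫₀^∞ T(z)/(1 + ρz) dz = A_x A_y ∑_{n=0}^∞ ∑_{k=0}^∞ B̃_x(n) B̃_y(k) · n! · k! · ∑_{i=0}^{n} ∑_{j=0}^{k} ((i+j)!/(i!·j!)) · (a_xⁱ a_y^j / ρ^{i+j}) · e^{(a_x+a_y)/ρ} · Γ(−(i+j), (a_x+a_y)/ρ). -/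

import Mathlib

open MeasureTheory Real Set Finset

/-- Upper incomplete Gamma function `Γ(n+1, x) = ∫_x^∞ tⁿ e^{-t} dt`. -/
noncomputable def uiGamma (n : ℕ) (x : ℝ) : ℝ :=
  ∫ t in Set.Ioi x, t ^ n * Real.exp (-t)

/-- Upper incomplete Gamma function of negative integer order:
    `Γ(-m, β) = ∫_β^∞ e^{-t} / t^{m+1} dt`. -/
noncomputable def uiGammaNeg (m : ℕ) (β : ℝ) : ℝ :=
  ∫ t in Set.Ioi β, Real.exp (-t) / t ^ (m + 1)

theorem integrableOn_pow_mul_exp_neg_mul (n : ℕ) {c : ℝ} (hc : 0 < c) :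
    IntegrableOn (fun z : ℝ => z ^ n * Real.exp (-(c * z))) (Set.Ioi 0) := by
  have h := integrableOn_rpow_mul_exp_neg_mul_rpow (p := 1) (s := n) (b := c)
    (by have : (0 : ℝ) ≤ n := n.cast_nonneg
        linarith) one_pos hc
  simpa using h

theorem integral_pow_mul_exp_neg_mul (n : ℕ) {c : ℝ} (hc : 0 < c) :
    ∫ z in Set.Ioi (0 : ℝ), z ^ n * Real.exp (-(c * z)) = n.factorial / c ^ (n + 1) := by
  have h := Real.integral_rpow_mul_exp_neg_mul_Ioi (a := (n + 1 : ℝ)) (by positivity) hc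
  rw [Real.Gamma_nat_eq_factorial] at h
  have e : (n : ℝ) + 1 = ((n + 1 : ℕ) : ℝ) := by push_cast; rfl
  simp only [add_sub_cancel_right, Real.rpow_natCast] at h
  rw [h, e, Real.rpow_natCast, one_div, inv_pow]
  field_simp

theorem integrableOn_pow_mul_exp_neg_Ioi (n : ℕ) {x : ℝ} (hx : 0 ≤ x) :
    IntegrableOn (fun t : ℝ => t ^ n * Real.exp (-t)) (Set.Ioi x) := by
  have h := integrableOn_pow_mul_exp_neg_mul n one_pos
  simp only [one_mul] at h
  exact h.mono_set (Set.Ioi_subset_Ioi hx)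

theorem uiGamma_zero (x : ℝ) : uiGamma 0 x = Real.exp (-x) := by
  simp only [uiGamma, pow_zero, one_mul, integral_exp_neg_Ioi]

theorem uiGamma_succ (n : ℕ) {x : ℝ} (hx : 0 ≤ x) :
    uiGamma (n + 1) x = x ^ (n + 1) * Real.exp (-x) + (n + 1) * uiGamma n x := by
  have h1 := integrableOn_pow_mul_exp_neg_Ioi (n + 1) hx
  have h0 := (integrableOn_pow_mul_exp_neg_Ioi n hx).const_mul ((n : ℝ) + 1)
  have key := integral_Ioi_of_hasDerivAt_of_tendsto (a := x) (m := 0)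
    (f := fun t : ℝ => t ^ (n + 1) * Real.exp (-t))
    (f' := fun t : ℝ => (n + 1) * (t ^ n * Real.exp (-t)) - t ^ (n + 1) * Real.exp (-t))
    (by fun_prop)
    (fun t _ => by
      have := (hasDerivAt_pow (n + 1) t).mul (hasDerivAt_neg t).exp
      refine this.congr_deriv ?_
      push_cast
      ring)
    (h0.sub h1) (Real.tendsto_pow_mul_exp_neg_atTop_nhds_zero (n + 1))
  rw [integral_sub h0 h1, integral_const_mul] at key
  unfold uiGamma
  linarith

/-- Closed form of the upper incomplete Gamma function of positive integer order. -/
theorem uiGamma_eq_sum (n : ℕ) {x : ℝ} (hx : 0 ≤ x) :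
    uiGamma n x =
      n.factorial * Real.exp (-x) * ∑ i ∈ Finset.range (n + 1), x ^ i / i.factorial := by
  induction n with
  | zero => simp [uiGamma_zero]
  | succ n ih =>
    rw [uiGamma_succ n hx, ih, Finset.sum_range_succ _ (n + 1), Nat.factorial_succ]
    push_cast
    field_simp
    ring

theorem uiGamma_nonneg (n : ℕ) {x : ℝ} (hx : 0 ≤ x) : 0 ≤ uiGamma n x := by
  rw [uiGamma_eq_sum n hx]
  positivity

theorem uiGamma_le (n : ℕ) {x : ℝ} (hx : 0 ≤ x) :
    uiGamma n x ≤ n.factorial * 2 ^ n * Real.exp (-(x / 2)) := by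
  have h : ∑ i ∈ Finset.range (n + 1), x ^ i / i.factorial ≤ 2 ^ n * Real.exp (x / 2) :=
    calc ∑ i ∈ Finset.range (n + 1), x ^ i / i.factorial
        ≤ ∑ i ∈ Finset.range (n + 1), 2 ^ n * ((x / 2) ^ i / i.factorial) := by
          refine Finset.sum_le_sum fun i hi => ?_
          have h2 : (2 : ℝ) ^ i ≤ 2 ^ n :=
            pow_le_pow_right₀ one_le_two (by simpa [Nat.lt_succ_iff] using hi)
          calc x ^ i / i.factorial = 2 ^ i * ((x / 2) ^ i / i.factorial) := by
                rw [div_pow]; field_simp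
            _ ≤ _ := by gcongr
      _ ≤ _ := by
          rw [← Finset.mul_sum]
          gcongr
          exact Real.sum_le_exp_of_nonneg (by positivity) _
  rw [uiGamma_eq_sum n hx]
  calc _ ≤ n.factorial * Real.exp (-x) * (2 ^ n * Real.exp (x / 2)) := by gcongr
    _ = n.factorial * 2 ^ n * (Real.exp (-x) * Real.exp (x / 2)) := by ring
    _ = _ := by rw [← Real.exp_add]; ring_nf

theorem integrableOn_exp_neg_div_pow (m : ℕ) {β : ℝ} (hβ : 0 < β) :
    IntegrableOn (fun t : ℝ => Real.exp (-t) / t ^ m) (Set.Ioi β) := by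
  have h := integrableOn_pow_mul_exp_neg_Ioi 0 hβ.le
  simp only [pow_zero, one_mul] at h
  refine Integrable.mono' (h.div_const (β ^ m)) (Measurable.aestronglyMeasurable (by fun_prop)) ?_
  filter_upwards [ae_restrict_mem measurableSet_Ioi] with t ht
  have ht' : β < t := ht
  have : 0 < t := hβ.trans ht'
  rw [Real.norm_of_nonneg (by positivity)]
  gcongr

theorem uiGammaNeg_succ (m : ℕ) {β : ℝ} (hβ : 0 < β) :
    (m + 1) * uiGammaNeg (m + 1) β = Real.exp (-β) / β ^ (m + 1) - uiGammaNeg m β := by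
  have h0 := integrableOn_exp_neg_div_pow (m + 1) hβ
  have h1 := (integrableOn_exp_neg_div_pow (m + 2) hβ).const_mul ((m : ℝ) + 1)
  have lim : Filter.Tendsto (fun t : ℝ => -(Real.exp (-t) / t ^ (m + 1))) Filter.atTop (nhds 0) := by
    have := Real.tendsto_exp_neg_atTop_nhds_zero.div_atTop
      (Filter.tendsto_pow_atTop (α := ℝ) (Nat.succ_ne_zero m))
    simpa using this.neg
  have key := integral_Ioi_of_hasDerivAt_of_tendsto (a := β) (m := 0)
    (f := fun t : ℝ => -(Real.exp (-t) / t ^ (m + 1)))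
    (f' := fun t : ℝ => Real.exp (-t) / t ^ (m + 1) + (m + 1) * (Real.exp (-t) / t ^ (m + 2)))
    (by
      refine ContinuousAt.continuousWithinAt ?_
      have : β ^ (m + 1) ≠ 0 := by positivity
      fun_prop (disch := assumption))
    (fun t ht => by
      have ht' : 0 < t := hβ.trans ht
      have := (((hasDerivAt_neg t).exp).div (hasDerivAt_pow (m + 1) t)
        (by positivity)).neg
      refine this.congr_deriv ?_
      push_cast
      field_simp
      ring)
    (h0.add h1) lim
  rw [integral_add h0 h1, integral_const_mul] at key
  unfold uiGammaNeg
  linarith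

theorem integral_exp_neg_mul_div_one_add_mul {c ρ : ℝ} (hc : 0 < c) (hρ : 0 < ρ) :
    ρ * ∫ z in Set.Ioi (0 : ℝ), Real.exp (-(c * z)) / (1 + ρ * z) =
      Real.exp (c / ρ) * uiGammaNeg 0 (c / ρ) := by
  have shift : uiGammaNeg 0 (c / ρ) =
      ∫ s in Set.Ioi (0 : ℝ), Real.exp (-(s + c / ρ)) / (s + c / ρ) := by
    have := (measurePreserving_add_right (volume : Measure ℝ) (c / ρ)).setIntegral_preimage_emb
      (MeasurableEquiv.addRight (c / ρ)).measurableEmbedding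
      (fun t => Real.exp (-t) / t ^ (0 + 1)) (Set.Ioi (c / ρ))
    simpa [uiGammaNeg] using this.symm
  have scale := integral_comp_mul_left_Ioi
    (fun s : ℝ => Real.exp (-(s + c / ρ)) / (s + c / ρ)) 0 hc
  rw [mul_zero, ← shift, smul_eq_mul] at scale
  have hscale : uiGammaNeg 0 (c / ρ) =
      c * ∫ z in Set.Ioi (0 : ℝ), Real.exp (-(c * z + c / ρ)) / (c * z + c / ρ) := by
    rw [scale]; field_simp
  rw [hscale, ← integral_const_mul, ← integral_const_mul, ← integral_const_mul]
  refine setIntegral_congr_fun measurableSet_Ioi fun z hz => ?_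
  have hz' : (0 : ℝ) < z := hz
  rw [neg_add, Real.exp_add, Real.exp_neg (c / ρ)]
  field_simp
  ring

theorem integrableOn_pow_mul_exp_neg_mul_div (m : ℕ) {c ρ : ℝ} (hc : 0 < c) (hρ : 0 < ρ) :
    IntegrableOn (fun z : ℝ => z ^ m * Real.exp (-(c * z)) / (1 + ρ * z)) (Set.Ioi 0) := by
  refine Integrable.mono' (integrableOn_pow_mul_exp_neg_mul m hc) (Measurable.aestronglyMeasurable (by fun_prop)) ?_
  filter_upwards [ae_restrict_mem measurableSet_Ioi] with z hz
  have hz' : (0 : ℝ) < z := hz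
  rw [Real.norm_of_nonneg (by positivity)]
  exact div_le_self (by positivity) (by nlinarith [mul_pos hρ hz'])

theorem integral_pow_mul_exp_neg_mul_div (m : ℕ) {c ρ : ℝ} (hc : 0 < c) (hρ : 0 < ρ) :
    ρ * ∫ z in Set.Ioi (0 : ℝ), z ^ m * Real.exp (-(c * z)) / (1 + ρ * z) =
      m.factorial / ρ ^ m * Real.exp (c / ρ) * uiGammaNeg m (c / ρ) := by
  induction m with
  | zero => simpa using integral_exp_neg_mul_div_one_add_mul hc hρ
  | succ m ih =>
    have h0 := integrableOn_pow_mul_exp_neg_mul_div m hc hρ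
    have h1 := integrableOn_pow_mul_exp_neg_mul_div (m + 1) hc hρ
    have split : ∫ z in Set.Ioi (0 : ℝ), z ^ m * Real.exp (-(c * z)) =
        (∫ z in Set.Ioi (0 : ℝ), z ^ m * Real.exp (-(c * z)) / (1 + ρ * z)) +
        ρ * ∫ z in Set.Ioi (0 : ℝ), z ^ (m + 1) * Real.exp (-(c * z)) / (1 + ρ * z) := by
      rw [← integral_const_mul, ← integral_add h0 (h1.const_mul ρ)]
      refine setIntegral_congr_fun measurableSet_Ioi fun z hz => ?_
      have hz' : (0 : ℝ) < z := hz
      field_simp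
      ring
    rw [integral_pow_mul_exp_neg_mul m hc] at split
    have hJ : ρ * ∫ z in Set.Ioi (0 : ℝ), z ^ (m + 1) * Real.exp (-(c * z)) / (1 + ρ * z) =
        m.factorial / c ^ (m + 1) -
          m.factorial / ρ ^ m * Real.exp (c / ρ) * uiGammaNeg m (c / ρ) / ρ := by
      rw [← ih, split]
      field_simp
      ring
    have hrec := uiGammaNeg_succ m (div_pos hc hρ)
    rw [hJ, Nat.factorial_succ]
    push_cast
    have e : ((m : ℝ) + 1) * m.factorial / ρ ^ (m + 1) * Real.exp (c / ρ) *
        uiGammaNeg (m + 1) (c / ρ) = m.factorial / ρ ^ (m + 1) * Real.exp (c / ρ) *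
        ((m + 1) * uiGammaNeg (m + 1) (c / ρ)) := by ring
    rw [e, hrec, Real.exp_neg, div_pow]
    field_simp
    ring

theorem uiGamma_mul_uiGamma_eq_sum (n k : ℕ) {a b z : ℝ} (ha : 0 < a) (hb : 0 < b)
    (hz : 0 ≤ z) :
    uiGamma n (a * z) * uiGamma k (b * z) = n.factorial * k.factorial *
      ∑ i ∈ Finset.range (n + 1), ∑ j ∈ Finset.range (k + 1),
        a ^ i * b ^ j / (i.factorial * j.factorial) *
          (z ^ (i + j) * Real.exp (-((a + b) * z))) := by
  rw [uiGamma_eq_sum n (by positivity), uiGamma_eq_sum k (by positivity)]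
  have e : ∀ i j : ℕ, a ^ i * b ^ j / (i.factorial * j.factorial : ℝ) *
      (z ^ (i + j) * Real.exp (-((a + b) * z))) =
      (Real.exp (-(a * z)) * Real.exp (-(b * z))) *
        ((a * z) ^ i / i.factorial * ((b * z) ^ j / j.factorial)) := by
    intro i j
    rw [← Real.exp_add, mul_pow, mul_pow, pow_add, show -(a * z) + -(b * z) = -((a + b) * z) by ring]
    ring
  simp_rw [e, ← Finset.mul_sum, ← Finset.sum_mul]
  ring

theorem integrableOn_uiGamma_mul_uiGamma_div (n k : ℕ) {a b ρ : ℝ} (ha : 0 < a) (hb : 0 < b)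
    (hρ : 0 < ρ) :
    IntegrableOn (fun z : ℝ => uiGamma n (a * z) * uiGamma k (b * z) / (1 + ρ * z))
      (Set.Ioi 0) := by
  have h : IntegrableOn (fun z : ℝ => n.factorial * k.factorial *
      ∑ i ∈ Finset.range (n + 1), ∑ j ∈ Finset.range (k + 1),
        a ^ i * b ^ j / (i.factorial * j.factorial) *
          (z ^ (i + j) * Real.exp (-((a + b) * z)) / (1 + ρ * z))) (Set.Ioi 0) :=
    (integrable_finsetSum _ fun i _ => integrable_finsetSum _ fun j _ =>
      (integrableOn_pow_mul_exp_neg_mul_div (i + j) (add_pos ha hb) hρ).const_mul _).const_mul _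
  refine h.congr_fun (fun z hz => ?_) measurableSet_Ioi
  rw [uiGamma_mul_uiGamma_eq_sum n k ha hb (le_of_lt hz)]
  simp_rw [mul_div_assoc, Finset.sum_div, mul_div_assoc]

theorem integral_uiGamma_mul_uiGamma_div (n k : ℕ) {a b ρ : ℝ} (ha : 0 < a) (hb : 0 < b)
    (hρ : 0 < ρ) :
    ρ * ∫ z in Set.Ioi (0 : ℝ), uiGamma n (a * z) * uiGamma k (b * z) / (1 + ρ * z) =
      n.factorial * k.factorial *
      ∑ i ∈ Finset.range (n + 1), ∑ j ∈ Finset.range (k + 1),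
        ((i + j).factorial / (i.factorial * j.factorial : ℝ)) *
        (a ^ i * b ^ j / ρ ^ (i + j)) * Real.exp ((a + b) / ρ) *
        uiGammaNeg (i + j) ((a + b) / ρ) := by
  have hint := fun i j : ℕ => (integrableOn_pow_mul_exp_neg_mul_div (i + j) (add_pos ha hb)
    hρ).const_mul (a ^ i * b ^ j / (i.factorial * j.factorial : ℝ))
  have e : ∫ z in Set.Ioi (0 : ℝ), uiGamma n (a * z) * uiGamma k (b * z) / (1 + ρ * z) =
      ∫ z in Set.Ioi (0 : ℝ), n.factorial * k.factorial *
      ∑ i ∈ Finset.range (n + 1), ∑ j ∈ Finset.range (k + 1),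
        a ^ i * b ^ j / (i.factorial * j.factorial) *
          (z ^ (i + j) * Real.exp (-((a + b) * z)) / (1 + ρ * z)) := by
    refine setIntegral_congr_fun measurableSet_Ioi fun z hz => ?_
    rw [uiGamma_mul_uiGamma_eq_sum n k ha hb (le_of_lt hz)]
    simp_rw [mul_div_assoc, Finset.sum_div, mul_div_assoc]
  rw [e, integral_const_mul,
    integral_finsetSum _ fun i _ => integrable_finsetSum _ fun j _ => hint i j, mul_left_comm,
    Finset.mul_sum]
  congr 1
  refine Finset.sum_congr rfl fun i _ => ?_
  rw [integral_finsetSum _ fun j _ => hint i j, Finset.mul_sum]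
  refine Finset.sum_congr rfl fun j _ => ?_
  rw [integral_const_mul, mul_left_comm,
    integral_pow_mul_exp_neg_mul_div (i + j) (add_pos ha hb) hρ]
  ring

/-- Termwise integration of a double series of products of incomplete Gamma functions. -/
theorem integral_tsum_uiGamma_mul_uiGamma_div {a b ρ : ℝ} (ha : 0 < a) (hb : 0 < b)
    (hρ : 0 < ρ) {u v : ℕ → ℝ} (hu : ∀ n, 0 ≤ u n) (hv : ∀ k, 0 ≤ v k)
    (hsu : Summable fun n : ℕ => u n * (n.factorial * 2 ^ n))
    (hsv : Summable fun k : ℕ => v k * (k.factorial * 2 ^ k)) :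
    ∫ z in Set.Ioi (0 : ℝ),
        (∑' n : ℕ, ∑' k : ℕ, u n * v k * uiGamma n (a * z) * uiGamma k (b * z)) / (1 + ρ * z) =
      ∑' n : ℕ, ∑' k : ℕ, u n * v k *
        ∫ z in Set.Ioi (0 : ℝ), uiGamma n (a * z) * uiGamma k (b * z) / (1 + ρ * z) := by
  set w : ℕ × ℕ → ℝ := fun p =>
    u p.1 * (p.1.factorial * 2 ^ p.1) * (v p.2 * (p.2.factorial * 2 ^ p.2)) with hw
  have hsw : Summable w := hsu.mul_of_nonneg hsv
    (fun n => mul_nonneg (hu n) (by positivity)) (fun k => mul_nonneg (hv k) (by positivity))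
  set g : ℝ → ℝ := fun z => Real.exp (-((a + b) / 2 * z)) with hg
  have hgi : IntegrableOn g (Set.Ioi 0) := by
    simpa using integrableOn_pow_mul_exp_neg_mul 0 (show 0 < (a + b) / 2 by positivity)
  set F : ℕ × ℕ → ℝ → ℝ := fun p z =>
    u p.1 * v p.2 * (uiGamma p.1 (a * z) * uiGamma p.2 (b * z) / (1 + ρ * z)) with hF
  have hF0 : ∀ p, ∀ z ∈ Set.Ioi (0 : ℝ), 0 ≤ F p z := fun p z hz => by
    have hz' : (0 : ℝ) < z := hz
    have := uiGamma_nonneg p.1 (mul_pos ha hz').le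
    have := uiGamma_nonneg p.2 (mul_pos hb hz').le
    have := hu p.1
    have := hv p.2
    positivity
  have hFle : ∀ p, ∀ z ∈ Set.Ioi (0 : ℝ), F p z ≤ w p * g z := fun p z hz => by
    have hz' : (0 : ℝ) < z := hz
    have h1 := uiGamma_nonneg p.1 (mul_pos ha hz').le
    have h2 := uiGamma_nonneg p.2 (mul_pos hb hz').le
    have h3 := hu p.1
    have h4 := hv p.2
    calc F p z ≤ u p.1 * v p.2 * (uiGamma p.1 (a * z) * uiGamma p.2 (b * z)) := by
          refine mul_le_mul_of_nonneg_left (div_le_self (by positivity) ?_) (by positivity)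
          nlinarith [mul_pos hρ hz']
      _ ≤ u p.1 * v p.2 * ((p.1.factorial * 2 ^ p.1 * Real.exp (-(a * z / 2))) *
            (p.2.factorial * 2 ^ p.2 * Real.exp (-(b * z / 2)))) := by
          gcongr
          · exact uiGamma_le _ (mul_pos ha hz').le
          · exact uiGamma_le _ (mul_pos hb hz').le
      _ = w p * (Real.exp (-(a * z / 2)) * Real.exp (-(b * z / 2))) := by
          simp only [hw]; ring
      _ = w p * g z := by rw [← Real.exp_add, hg]; ring_nf
  have hFi : ∀ p, IntegrableOn (F p) (Set.Ioi 0) := fun p =>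
    (integrableOn_uiGamma_mul_uiGamma_div p.1 p.2 ha hb hρ).const_mul _
  have hnorm : Summable fun p => ∫ z in Set.Ioi (0 : ℝ), ‖F p z‖ := by
    refine Summable.of_nonneg_of_le (fun p => integral_nonneg fun z => norm_nonneg _)
      (fun p => ?_) (hsw.mul_right (∫ z in Set.Ioi (0 : ℝ), g z))
    rw [← integral_const_mul]
    refine setIntegral_mono_on (hFi p).norm (hgi.const_mul _) measurableSet_Ioi fun z hz => ?_
    rw [Real.norm_of_nonneg (hF0 p z hz)]
    exact hFle p z hz
  have key := hasSum_integral_of_summable_integral_norm hFi hnorm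
  have hI : ∫ z in Set.Ioi (0 : ℝ), ∑' p, F p z = ∫ z in Set.Ioi (0 : ℝ),
      (∑' n : ℕ, ∑' k : ℕ, u n * v k * uiGamma n (a * z) * uiGamma k (b * z)) / (1 + ρ * z) := by
    refine setIntegral_congr_fun measurableSet_Ioi fun z hz => ?_
    have hs : Summable fun p => F p z :=
      (hsw.mul_right (g z)).of_nonneg_of_le (fun p => hF0 p z hz) (fun p => hFle p z hz)
    rw [hs.tsum_prod, ← tsum_div_const]
    refine tsum_congr fun n => ?_
    rw [← tsum_div_const]
    refine tsum_congr fun k => ?_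
    simp only [hF]
    ring
  rw [← hI, ← key.tsum_eq, key.summable.tsum_prod]
  simp only [hF, integral_const_mul]

theorem summable_pow_div_factorial_sq_div_mul (P a : ℝ) :
    Summable fun n : ℕ => P ^ n / (n.factorial : ℝ) ^ 2 / a * (n.factorial * 2 ^ n) := by
  refine ((Real.summable_pow_div_factorial (P * 2)).div_const a).congr fun n => ?_
  rw [mul_pow]
  field_simp

/-- With the Rician parameters `a_x = (1+K_x)/Ω_x`, `A_x = a_x e^{-K_x}`,
    `B̃_x(n) = ((K_x(1+K_x)/Ω_x)ⁿ/(n!)²)/a_x` (and similarly for the `y` link), and the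
    tail function `T(z) = A_x A_y ∑_{n,k} B̃_x(n) B̃_y(k) Γ(n+1, a_x z) Γ(k+1, a_y z)`,
    for every `ρ > 0` one has
    `ρ ∫₀^∞ T(z)/(1+ρz) dz = A_x A_y ∑_{n,k} B̃_x(n) B̃_y(k) n! k!
       ∑_{i=0}^{n} ∑_{j=0}^{k} ((i+j)!/(i! j!)) (a_xⁱ a_y^j / ρ^{i+j})
         e^{(a_x+a_y)/ρ} Γ(-(i+j), (a_x+a_y)/ρ)`. -/
theorem integral_tail_eq_double_series (Kx Ky Ωx Ωy ρ : ℝ)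
    (hKx : 0 ≤ Kx) (hKy : 0 ≤ Ky) (hΩx : 0 < Ωx) (hΩy : 0 < Ωy) (hρ : 0 < ρ)
    (ax ay Ax Ay : ℝ) (Bx By : ℕ → ℝ)
    (hax : ax = (1 + Kx) / Ωx) (hay : ay = (1 + Ky) / Ωy)
    (hAx : Ax = ax * Real.exp (-Kx)) (hAy : Ay = ay * Real.exp (-Ky))
    (hBx : ∀ n, Bx n = ((Kx * (1 + Kx) / Ωx) ^ n / ((Nat.factorial n : ℝ)) ^ 2) / ax)
    (hBy : ∀ k, By k = ((Ky * (1 + Ky) / Ωy) ^ k / ((Nat.factorial k : ℝ)) ^ 2) / ay) :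
    ρ * ∫ z in Set.Ioi (0 : ℝ),
        (Ax * Ay * ∑' n : ℕ, ∑' k : ℕ,
          Bx n * By k * uiGamma n (ax * z) * uiGamma k (ay * z)) / (1 + ρ * z)
      = Ax * Ay * ∑' n : ℕ, ∑' k : ℕ,
          Bx n * By k * (Nat.factorial n : ℝ) * (Nat.factorial k : ℝ) *
          ∑ i ∈ Finset.range (n + 1), ∑ j ∈ Finset.range (k + 1),
            ((Nat.factorial (i + j) : ℝ) / ((Nat.factorial i : ℝ) * (Nat.factorial j : ℝ))) *
            (ax ^ i * ay ^ j / ρ ^ (i + j)) * Real.exp ((ax + ay) / ρ) *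
            uiGammaNeg (i + j) ((ax + ay) / ρ) := by
  have ha : 0 < ax := hax ▸ by positivity
  have hb : 0 < ay := hay ▸ by positivity
  obtain rfl : Bx = _ := funext hBx
  obtain rfl : By = _ := funext hBy
  have key := integral_tsum_uiGamma_mul_uiGamma_div ha hb hρ
    (fun n => by positivity) (fun k => by positivity)
    (summable_pow_div_factorial_sq_div_mul (Kx * (1 + Kx) / Ωx) ax)
    (summable_pow_div_factorial_sq_div_mul (Ky * (1 + Ky) / Ωy) ay)
  simp_rw [mul_div_assoc (Ax * Ay), integral_const_mul]
  rw [key, mul_left_comm, ← tsum_mul_left]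
  congr 1
  refine tsum_congr fun n => ?_
  rw [← tsum_mul_left]
  refine tsum_congr fun k => ?_
  rw [mul_left_comm, integral_uiGamma_mul_uiGamma_div n k ha hb hρ]
  ring
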